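/- A compact Hausdorff space K is weakly Radon–Nikodým if and only if there exist a set Γ and a homeomorphic embedding i : K → [0,1]^Γ such that for all real numbers p < q, the family of disjoint pairs of subsets (A_α⁰, A_α¹)_{α∈Γ} does not contain an independent sequence, where A_α⁰ = {x ∈ K : x_α < p} and A_α¹ = {x ∈ K : x_α > q} for every α ∈ Γ (here x_α denotes the α-th coordinate of i(x)). -/

import Mathlib

open Set Function

/-- A sequence of pairs of subsets `(A n, B n)` of a set `S` is *independent* if for every
`n` and every choice function `ε`, the intersection over `k < n` of `A k` (if `ε k = 0/false`)
or `B k` (if `ε k = 1/true`) is nonempty. -/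
def IsIndependentSeq {S : Type*} (A B : ℕ → Set S) : Prop :=
  ∀ (n : ℕ) (ε : Fin n → Bool),
    (⋂ k : Fin n, if ε k = true then B (k : ℕ) else A (k : ℕ)).Nonempty

/-- A real Banach space `X` *contains an isomorphic copy of `ℓ¹`* if there is a bounded
linear map from `ℓ¹` into `X` which is an isomorphism onto its image, i.e. bounded below. -/
def ContainsL1 (X : Type*) [NormedAddCommGroup X] [NormedSpace ℝ X] : Prop :=
  ∃ T : lp (fun _ : ℕ => ℝ) 1 →L[ℝ] X, ∃ c : ℝ, 0 < c ∧ ∀ v, c * ‖v‖ ≤ ‖T v‖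

/-- A compact (Hausdorff) space is *weakly Radon–Nikodým* if it is homeomorphic to a
weak*-compact subset of the dual of a real Banach space not containing a copy of `ℓ¹`. -/
def IsWRN (K : Type*) [TopologicalSpace K] : Prop :=
  ∃ (X : Type) (_ : NormedAddCommGroup X) (_ : NormedSpace ℝ X) (_ : CompleteSpace X)
    (S : Set (WeakDual ℝ X)), ¬ ContainsL1 X ∧ IsCompact S ∧ Nonempty (K ≃ₜ S)

section Independence

open Filter Topology MeasureTheory

/-- A class of nonempty sets that can be refined frequently by both members of a pair `(A n, B n)`
yields an independent subsequence. -/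
lemma exists_isIndependentSeq_of_eventually {S : Type*} (A B : ℕ → Set S) (l : Filter ℕ) [l.NeBot]
    (P : Set (Set S)) (huniv : univ ∈ P) (hne : ∀ s ∈ P, s.Nonempty)
    (hP : ∀ s ∈ P, ∀ᶠ n in l, s ∩ A n ∈ P ∧ s ∩ B n ∈ P) :
    ∃ φ : ℕ → ℕ, IsIndependentSeq (fun n => A (φ n)) (fun n => B (φ n)) := by
  have step : ∀ F : {F : Set (Set S) // F.Finite ∧ F ⊆ P},
      ∃ n, ∀ s ∈ F.1, s ∩ A n ∈ P ∧ s ∩ B n ∈ P := fun F =>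
    ((eventually_all_finite F.2.1).2 fun s hs => hP s (F.2.2 hs)).exists
  choose next hnext using step
  let refinement : {F : Set (Set S) // F.Finite ∧ F ⊆ P} → {F : Set (Set S) // F.Finite ∧ F ⊆ P} :=
    fun F => ⟨(· ∩ A (next F)) '' F.1 ∪ (· ∩ B (next F)) '' F.1,
      (F.2.1.image _).union (F.2.1.image _), by
        rintro _ (⟨s, hs, rfl⟩ | ⟨s, hs, rfl⟩)
        exacts [(hnext F s hs).1, (hnext F s hs).2]⟩
  let F : ℕ → {F : Set (Set S) // F.Finite ∧ F ⊆ P} := fun n =>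
    Nat.rec ⟨{univ}, finite_singleton _, by simpa using huniv⟩ (fun _ => refinement) n
  refine ⟨fun n => next (F n), fun n ε => ?_⟩
  suffices h : ∀ (n : ℕ) (ε : Fin n → Bool),
      (⋂ k : Fin n, if ε k = true then B (next (F k)) else A (next (F k))) ∈ (F n).1 from
    hne _ ((F n).2.2 (h n ε))
  intro n
  induction n with
  | zero => intro ε; simp [F]
  | succ n ih =>
    intro ε
    have hsplit : (⋂ k : Fin (n + 1), if ε k = true then B (next (F k)) else A (next (F k))) =
        (⋂ k : Fin n, if ε k.castSucc = true then B (next (F k)) else A (next (F k))) ∩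
          (if ε (Fin.last n) = true then B (next (F n)) else A (next (F n))) := by
      ext x
      simp only [mem_iInter, mem_inter_iff, Fin.forall_fin_succ', Fin.val_castSucc, Fin.val_last]
    rw [hsplit]
    have := ih fun k => ε k.castSucc
    by_cases hε : ε (Fin.last n) = true
    · rw [if_pos hε]
      exact Or.inr ⟨_, this, rfl⟩
    · rw [if_neg hε]
      exact Or.inl ⟨_, this, rfl⟩

variable {Ω : Type*} [MeasurableSpace Ω] (μ : Measure Ω) [IsFiniteMeasure μ]

/-- Along an ultrafilter, a sequence of sets has a weak limit density. -/
lemma exists_tendsto_measureReal_inter (l : Ultrafilter ℕ) (B : ℕ → Set Ω)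
    (hB : ∀ n, MeasurableSet (B n)) :
    ∃ β : Ω → ℝ, Measurable β ∧ Integrable β μ ∧ ∀ s, MeasurableSet s →
      Tendsto (fun n => μ.real (s ∩ B n)) l (𝓝 (∫ x in s, β x ∂μ)) := by
  let b : ℕ → Lp ℝ 2 μ := fun n => indicatorConstLp 2 (hB n) (measure_ne_top μ _) (1 : ℝ)
  let g : ℕ → WeakDual ℝ (Lp ℝ 2 μ) := fun n =>
    StrongDual.toWeakDual (InnerProductSpace.toDual ℝ (Lp ℝ 2 μ) (b n))
  obtain ⟨R, hR⟩ : ∃ R, ∀ n, ‖b n‖ ≤ R := by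
    refine ⟨(μ.real univ) ^ ((1 : ℝ) / 2), fun n => ?_⟩
    have := norm_indicatorConstLp_le (p := 2) (μ := μ) (hs := hB n) (hμs := measure_ne_top μ _)
      (c := (1 : ℝ))
    refine this.trans ?_
    simp only [norm_one, one_mul, ENNReal.toReal_ofNat]
    exact Real.rpow_le_rpow measureReal_nonneg (measureReal_mono (subset_univ _)) (by norm_num)
  obtain ⟨Λ, -, hΛ⟩ := isCompact_iff_ultrafilter_le_nhds.1
    (WeakDual.isCompact_closedBall (𝕜 := ℝ) (E := Lp ℝ 2 μ) 0 R) (l.map g) (by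
      rw [Ultrafilter.coe_map, le_principal_iff, mem_map]
      refine univ_mem' fun n => ?_
      simpa [g] using hR n)
  let β : Lp ℝ 2 μ := (InnerProductSpace.toDual ℝ (Lp ℝ 2 μ)).symm (WeakDual.toStrongDual Λ)
  refine ⟨β, (Lp.stronglyMeasurable β).measurable, (Lp.memLp β).integrable (by norm_num),
    fun s hs => ?_⟩
  have h1 := ((WeakDual.eval_continuous
    (indicatorConstLp 2 hs (measure_ne_top μ _) (1 : ℝ) : Lp ℝ 2 μ)).tendsto Λ).comp hΛ
  have h2 : Λ (indicatorConstLp 2 hs (measure_ne_top μ _) (1 : ℝ)) = ∫ x in s, β x ∂μ := by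
    rw [← L2.inner_indicatorConstLp_one hs (measure_ne_top μ _) β, real_inner_comm]
    exact (InnerProductSpace.toDual_symm_apply (𝕜 := ℝ) (E := Lp ℝ 2 μ)
      (x := indicatorConstLp 2 hs (measure_ne_top μ _) (1 : ℝ))
      (y := WeakDual.toStrongDual Λ)).symm
  rw [← h2]
  have h3 : Tendsto (fun n => g n (indicatorConstLp 2 hs (measure_ne_top μ _) (1 : ℝ))) l
      (𝓝 (Λ (indicatorConstLp 2 hs (measure_ne_top μ _) (1 : ℝ)))) := h1
  refine h3.congr fun n => ?_
  have h4 : g n (indicatorConstLp 2 hs (measure_ne_top μ _) (1 : ℝ)) =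
      inner ℝ (b n) (indicatorConstLp 2 hs (measure_ne_top μ _) (1 : ℝ)) :=
    InnerProductSpace.toDual_apply_apply (𝕜 := ℝ)
  rw [h4, L2.real_inner_indicatorConstLp_one_indicatorConstLp_one, inter_comm]

/-- Either a sequence of pairs of measurable sets has an independent subsequence, or the pairs are
asymptotically separated by a fixed measurable set. -/
lemma exists_isIndependentSeq_or_tendsto_measureReal (l : Ultrafilter ℕ) (A B : ℕ → Set Ω)
    (hA : ∀ n, MeasurableSet (A n)) (hB : ∀ n, MeasurableSet (B n)) :
    (∃ φ : ℕ → ℕ, IsIndependentSeq (fun n => A (φ n)) (fun n => B (φ n))) ∨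
      ∃ s, MeasurableSet s ∧ Tendsto (fun n => μ.real (s ∩ A n)) l (𝓝 0) ∧
        Tendsto (fun n => μ.real (sᶜ ∩ B n)) l (𝓝 0) := by
  obtain ⟨α, hαm, hαi, hα⟩ := exists_tendsto_measureReal_inter μ l A hA
  obtain ⟨β, hβm, hβi, hβ⟩ := exists_tendsto_measureReal_inter μ l B hB
  have hsα : MeasurableSet {x | 0 < α x} := measurableSet_lt measurable_const hαm
  have hsβ : MeasurableSet {x | 0 < β x} := measurableSet_lt measurable_const hβm
  have zero_of_nonpos : ∀ (C : ℕ → Set Ω) (s : Set Ω) (γ : Ω → ℝ),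
      Tendsto (fun n => μ.real (s ∩ C n)) l (𝓝 (∫ x in s, γ x ∂μ)) → ∫ x in s, γ x ∂μ ≤ 0 →
      Tendsto (fun n => μ.real (s ∩ C n)) l (𝓝 0) := by
    intro C s γ h h0
    rwa [le_antisymm h0 (ge_of_tendsto' h fun n => measureReal_nonneg)] at h
  by_cases hE : μ ({x | 0 < α x} ∩ {x | 0 < β x}) = 0
  · right
    refine ⟨{x | 0 < α x}ᶜ, hsα.compl, ?_, ?_⟩
    · refine zero_of_nonpos A _ α (hα _ hsα.compl) (setIntegral_nonpos hsα.compl ?_)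
      intro x hx
      simpa using hx
    · rw [compl_compl]
      refine zero_of_nonpos B _ β (hβ _ hsα) ?_
      refine integral_nonpos_of_ae ?_
      rw [EventuallyLE, ae_restrict_iff' hsα]
      filter_upwards [measure_eq_zero_iff_ae_notMem.1 hE] with x hx hx'
      by_contra hcon
      exact hx ⟨hx', not_le.1 hcon⟩
  · left
    set E := {x | 0 < α x} ∩ {x | 0 < β x} with hEdef
    have hEm : MeasurableSet E := hsα.inter hsβ
    have key : ∀ (C : ℕ → Set Ω) (γ : Ω → ℝ), (∀ x ∈ E, 0 < γ x) → Integrable γ μ →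
        (∀ s, MeasurableSet s → Tendsto (fun n => μ.real (s ∩ C n)) l (𝓝 (∫ x in s, γ x ∂μ))) →
        ∀ s, MeasurableSet s → μ (E ∩ s) ≠ 0 → ∀ᶠ n in (l : Filter ℕ), μ (E ∩ (s ∩ C n)) ≠ 0 := by
      intro C γ hγE hγ h s hs hμ
      have hpos : 0 < ∫ x in E ∩ s, γ x ∂μ := by
        refine (setIntegral_pos_iff_support_of_nonneg_ae ?_ hγ.integrableOn).2 ?_
        · rw [EventuallyLE, ae_restrict_iff' (hEm.inter hs)]
          exact Eventually.of_forall fun x hx => (hγE x hx.1).le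
        · refine lt_of_lt_of_le (pos_iff_ne_zero.2 hμ) (measure_mono fun x hx => ?_)
          exact ⟨(hγE x hx.1).ne', hx⟩
      filter_upwards [(h _ (hEm.inter hs)).eventually_const_lt hpos] with n hn h0
      rw [inter_assoc, measureReal_def, h0] at hn
      simp at hn
    refine exists_isIndependentSeq_of_eventually A B l {s | MeasurableSet s ∧ μ (E ∩ s) ≠ 0}
      ⟨MeasurableSet.univ, by simpa using hE⟩ ?_ ?_
    · rintro s ⟨-, hs⟩
      exact (nonempty_of_measure_ne_zero hs).mono inter_subset_right
    · rintro s ⟨hs, hμ⟩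
      filter_upwards [key A α (fun x hx => hx.1) hαi hα s hs hμ,
        key B β (fun x hx => hx.2) hβi hβ s hs hμ] with n h1 h2
      exact ⟨⟨hs.inter (hA n), h1⟩, ⟨hs.inter (hB n), h2⟩⟩

end Independence

section WeaklyNull

open Filter Topology MeasureTheory

lemma abs_sub_average_le {x : ℝ} (h0 : 0 ≤ x) (h1 : x ≤ 1) {k : ℕ} (hk : 0 < k) (c : ℕ → Prop)
    [DecidablePred c] (w : ℕ → ℝ) (hw0 : ∀ i, 0 ≤ w i)
    (hw1 : ∀ i, c i → x < i / k → 1 ≤ w i)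
    (hw2 : ∀ i, ¬ c i → (i + 1) / k < x → 1 ≤ w i) :
    |x - (∑ i ∈ Finset.range k, if c i then (1 : ℝ) else 0) / k| ≤
      1 / k + ∑ i ∈ Finset.range k, w i := by
  have hk' : (0 : ℝ) < k := by exact_mod_cast hk
  rw [Finset.sum_boole]
  have hcard := Finset.card_filter_add_card_filter_not (s := Finset.range k) c
  rw [Finset.card_range] at hcard
  have hW : 0 ≤ ∑ i ∈ Finset.range k, w i := Finset.sum_nonneg fun i _ => hw0 i
  set m := (Finset.filter c (Finset.range k)).card with hm
  by_cases hbad : ∃ i ∈ Finset.range k, 1 ≤ w i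
  · obtain ⟨i, hi, hwi⟩ := hbad
    have hWi := Finset.single_le_sum (fun j _ => hw0 j) hi
    have hm1 : (m : ℝ) / k ≤ 1 := by
      rw [div_le_one hk']
      exact_mod_cast (by omega : m ≤ k)
    have hm0 : 0 ≤ (m : ℝ) / k := by positivity
    have : 0 ≤ 1 / (k : ℝ) := by positivity
    rw [abs_le]
    constructor <;> linarith
  · push Not at hbad
    have hx1 : (m : ℝ) ≤ k * x + 1 := by
      have : m ≤ ⌊k * x⌋₊ + 1 := by
        rw [hm, ← Finset.card_range (⌊k * x⌋₊ + 1)]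
        refine Finset.card_le_card fun i hi => ?_
        rw [Finset.mem_filter] at hi
        rw [Finset.mem_range, Nat.lt_succ_iff, Nat.le_floor_iff (by positivity)]
        by_contra hcon
        refine absurd (hw1 i hi.2 ?_) (not_le.2 (hbad i hi.1))
        rw [lt_div_iff₀ hk']
        linarith [not_le.1 hcon]
      have h2 : ((⌊k * x⌋₊ + 1 : ℕ) : ℝ) ≤ k * x + 1 := by
        push_cast
        linarith [Nat.floor_le (show 0 ≤ k * x by positivity)]
      exact le_trans (by exact_mod_cast this) h2
    have hx2 : k * x - 1 ≤ (m : ℝ) := by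
      have h3 : (Finset.filter (fun i => ¬ c i) (Finset.range k)).card ≤ k - (⌈k * x⌉₊ - 1) := by
        rw [← Nat.card_Ico]
        refine Finset.card_le_card fun i hi => ?_
        rw [Finset.mem_filter] at hi
        rw [Finset.mem_Ico]
        refine ⟨?_, Finset.mem_range.1 hi.1⟩
        rw [tsub_le_iff_right, Nat.ceil_le]
        by_contra hcon
        refine absurd (hw2 i hi.2 ?_) (not_le.2 (hbad i hi.1))
        rw [div_lt_iff₀ hk']
        push_cast at hcon
        linarith [not_le.1 hcon]
      have h4 : ⌈k * x⌉₊ ≤ k := Nat.ceil_le.2 (by nlinarith)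
      have h5 : ⌈k * x⌉₊ ≤ m + 1 := by omega
      have h6 : ((⌈k * x⌉₊ : ℕ) : ℝ) ≤ m + 1 := by exact_mod_cast h5
      linarith [Nat.le_ceil (k * x)]
    have : |x - (m : ℝ) / k| ≤ 1 / k := by
      rw [show x - (m : ℝ) / k = (k * x - m) / k by field_simp, abs_div, abs_of_pos hk']
      gcongr
      rw [abs_le]
      constructor <;> linarith
    linarith

variable {Ω : Type*} [MeasurableSpace Ω] (μ : Measure Ω) [IsProbabilityMeasure μ]

lemma tendsto_setIntegral_of_orthogonal (e : ℕ → Ω → ℝ) (hem : ∀ n, Measurable (e n))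
    (he : ∀ n ω, |e n ω| = 1) (horth : ∀ m n, m < n → ∫ ω, e n ω * e m ω ∂μ = 0)
    {s : Set Ω} (hs : MeasurableSet s) : Tendsto (fun n => ∫ ω in s, e n ω ∂μ) atTop (𝓝 0) := by
  have hmem : ∀ n, MemLp (e n) 2 μ := fun n =>
    MemLp.of_bound (hem n).aestronglyMeasurable 1 (Eventually.of_forall fun ω => (he n ω).le)
  let v : ℕ → Lp ℝ 2 μ := fun n => (hmem n).toLp
  have hv : ∀ m n, inner ℝ (v m) (v n) = ∫ ω, e n ω * e m ω ∂μ := by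
    intro m n
    rw [L2.inner_def]
    refine integral_congr_ae ?_
    filter_upwards [(hmem m).coeFn_toLp, (hmem n).coeFn_toLp] with ω h1 h2
    simp [v, h1, h2]
  have horthn : Orthonormal ℝ v := by
    rw [orthonormal_iff_ite]
    intro m n
    rw [hv]
    split_ifs with h
    · subst h
      have : ∀ ω, e m ω * e m ω = 1 := fun ω => by
        rw [← abs_mul_abs_self, he, one_mul]
      simp [this]
    · rcases lt_or_gt_of_ne h with h | h
      · exact horth _ _ h
      · simpa only [mul_comm] using horth _ _ h
  have hsum := (horthn.inner_products_summable
    (x := indicatorConstLp 2 hs (measure_ne_top μ _) (1 : ℝ))).tendsto_atTop_zero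
  have hval : ∀ n, inner ℝ (v n) (indicatorConstLp 2 hs (measure_ne_top μ _) (1 : ℝ)) =
      ∫ ω in s, e n ω ∂μ := by
    intro n
    rw [real_inner_comm, L2.inner_indicatorConstLp_one]
    exact integral_congr_ae (ae_restrict_of_ae (hmem n).coeFn_toLp)
  simp only [hval] at hsum
  rw [tendsto_zero_iff_norm_tendsto_zero]
  have := hsum.sqrt
  simpa [Real.sqrt_sq_eq_abs] using this

/-- A sequence of functions correlated with an orthonormal sequence of signs has an independent
subsequence of sublevel and superlevel sets. -/
lemma exists_isIndependentSeq_of_orthogonal (e g : ℕ → Ω → ℝ) (hem : ∀ n, Measurable (e n))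
    (he : ∀ n ω, |e n ω| = 1) (horth : ∀ m n, m < n → ∫ ω, e n ω * e m ω ∂μ = 0)
    (hgm : ∀ n, Measurable (g n)) (hg : ∀ n ω, g n ω ∈ Icc (0 : ℝ) 1)
    {δ : ℝ} (hδ : 0 < δ) (hcorr : ∀ n, δ ≤ |∫ ω, e n ω * g n ω ∂μ|) :
    ∃ p q : ℝ, p < q ∧ ∃ φ : ℕ → ℕ,
      IsIndependentSeq (fun n => {ω | g (φ n) ω < p}) (fun n => {ω | g (φ n) ω > q}) := by
  by_contra hcon
  push Not at hcon
  obtain ⟨k, hk⟩ := exists_nat_gt (1 / δ)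
  have hk0 : (0 : ℝ) < k := lt_trans (by positivity) hk
  have hkn : 0 < k := by exact_mod_cast hk0
  have hA : ∀ p n, MeasurableSet {ω | g n ω < p} := fun p n =>
    measurableSet_lt (hgm n) measurable_const
  have hB : ∀ q n, MeasurableSet {ω | g n ω > q} := fun q n =>
    measurableSet_lt measurable_const (hgm n)
  have hsep : ∀ i : ℕ, ∃ s, MeasurableSet s ∧
      Tendsto (fun n => μ.real (s ∩ {ω | g n ω < i / k})) (hyperfilter ℕ) (𝓝 0) ∧
      Tendsto (fun n => μ.real (sᶜ ∩ {ω | g n ω > (i + 1) / k})) (hyperfilter ℕ) (𝓝 0) := by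
    intro i
    refine (exists_isIndependentSeq_or_tendsto_measureReal μ (hyperfilter ℕ) _ _
      (hA (i / k)) (hB ((i + 1) / k))).resolve_left ?_
    rintro ⟨φ, hφ⟩
    exact hcon (i / k) ((i + 1) / k) (by gcongr; linarith) φ hφ
  choose s hs hsA hsB using hsep
  classical
  let w : ℕ → ℕ → Ω → ℝ := fun n i ω =>
    (s i ∩ {ω | g n ω < i / k}).indicator 1 ω + ((s i)ᶜ ∩ {ω | g n ω > (i + 1) / k}).indicator 1 ω
  have hwint : ∀ n i, Integrable (w n i) μ := fun n i =>
    ((integrable_const (1 : ℝ)).indicator ((hs i).inter (hA _ n))).add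
      ((integrable_const (1 : ℝ)).indicator ((hs i).compl.inter (hB _ n)))
  have hbd : ∀ n, δ ≤ |∑ i ∈ Finset.range k, ∫ ω in s i, e n ω ∂μ| / k + (1 / k +
      ∑ i ∈ Finset.range k, (μ.real (s i ∩ {ω | g n ω < i / k}) +
        μ.real ((s i)ᶜ ∩ {ω | g n ω > (i + 1) / k}))) := by
    intro n
    let h : Ω → ℝ := fun ω => (∑ i ∈ Finset.range k, if ω ∈ s i then (1 : ℝ) else 0) / k
    have hpt : ∀ ω, |g n ω - h ω| ≤ 1 / k + ∑ i ∈ Finset.range k, w n i ω := by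
      intro ω
      refine abs_sub_average_le (hg n ω).1 (hg n ω).2 hkn (fun i => ω ∈ s i) (fun i => w n i ω)
        (fun i => ?_) (fun i hi hx => ?_) (fun i hi hx => ?_)
      · exact add_nonneg (indicator_nonneg (fun _ _ => zero_le_one) _)
          (indicator_nonneg (fun _ _ => zero_le_one) _)
      · simp [w, hi, hx]
      · simp [w, hi, hx]
    have hei : Integrable (e n) μ :=
      Integrable.of_bound (hem n).aestronglyMeasurable 1 (Eventually.of_forall fun ω => (he n ω).le)
    have heh : ∀ ω, e n ω * h ω =
        (∑ i ∈ Finset.range k, (s i).indicator (e n) ω) / k := by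
      intro ω
      simp only [h, ← mul_div_assoc, Finset.mul_sum, indicator_apply, mul_ite, mul_one, mul_zero]
    have hehi : Integrable (fun ω => e n ω * h ω) μ := by
      simp only [heh]
      exact (integrable_finsetSum _ fun i _ => hei.indicator (hs i)).div_const _
    have hehv : ∫ ω, e n ω * h ω ∂μ = (∑ i ∈ Finset.range k, ∫ ω in s i, e n ω ∂μ) / k := by
      simp only [heh]
      rw [integral_div, integral_finsetSum _ fun i _ => hei.indicator (hs i)]
      simp only [integral_indicator (hs _)]
    have hegi : Integrable (fun ω => e n ω * g n ω) μ := by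
      refine Integrable.of_bound ((hem n).mul (hgm n)).aestronglyMeasurable 1
        (Eventually.of_forall fun ω => ?_)
      rw [Real.norm_eq_abs, abs_mul, he, one_mul, abs_of_nonneg (hg n ω).1]
      exact (hg n ω).2
    have hdom : Integrable (fun ω => 1 / (k : ℝ) + ∑ i ∈ Finset.range k, w n i ω) μ :=
      (integrable_const _).add (integrable_finsetSum _ fun i _ => hwint n i)
    have h1 : ‖∫ ω, (e n ω * g n ω - e n ω * h ω) ∂μ‖ ≤
        ∫ ω, (1 / (k : ℝ) + ∑ i ∈ Finset.range k, w n i ω) ∂μ := by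
      refine norm_integral_le_of_norm_le hdom (Eventually.of_forall fun ω => ?_)
      rw [Real.norm_eq_abs, ← mul_sub, abs_mul, he, one_mul]
      exact hpt ω
    have h2 : ∫ ω, (1 / (k : ℝ) + ∑ i ∈ Finset.range k, w n i ω) ∂μ =
        1 / k + ∑ i ∈ Finset.range k, (μ.real (s i ∩ {ω | g n ω < i / k}) +
        μ.real ((s i)ᶜ ∩ {ω | g n ω > (i + 1) / k})) := by
      rw [integral_add (integrable_const _) (integrable_finsetSum _ fun i _ => hwint n i),
        integral_finsetSum _ fun i _ => hwint n i]
      congr 1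
      · simp
      · refine Finset.sum_congr rfl fun i _ => ?_
        refine (integral_add ((integrable_const (1 : ℝ)).indicator ((hs i).inter (hA _ n)))
          ((integrable_const (1 : ℝ)).indicator ((hs i).compl.inter (hB _ n)))).trans ?_
        erw [integral_indicator_one ((hs i).inter (hA _ n)),
          integral_indicator_one ((hs i).compl.inter (hB _ n))]
    rw [integral_sub hegi hehi, h2, hehv, Real.norm_eq_abs] at h1
    have h3 := hcorr n
    have h4 := abs_sub_abs_le_abs_sub (∫ ω, e n ω * g n ω ∂μ)
      ((∑ i ∈ Finset.range k, ∫ ω in s i, e n ω ∂μ) / k)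
    rw [abs_div, abs_of_pos hk0] at h4
    linarith
  have hle : ((hyperfilter ℕ : Ultrafilter ℕ) : Filter ℕ) ≤ atTop := by
    rw [← Nat.cofinite_eq_atTop]
    exact hyperfilter_le_cofinite
  have hlim : Tendsto (fun n => |∑ i ∈ Finset.range k, ∫ ω in s i, e n ω ∂μ| / k + (1 / k +
      ∑ i ∈ Finset.range k, (μ.real (s i ∩ {ω | g n ω < i / k}) +
        μ.real ((s i)ᶜ ∩ {ω | g n ω > (i + 1) / k})))) (hyperfilter ℕ)
      (𝓝 (|∑ i ∈ Finset.range k, (0 : ℝ)| / k +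
        (1 / k + ∑ i ∈ Finset.range k, ((0 : ℝ) + 0)))) := by
    refine Tendsto.add (Tendsto.div_const (Tendsto.abs ?_) _) (tendsto_const_nhds.add ?_)
    · exact tendsto_finsetSum _ fun i _ =>
        (tendsto_setIntegral_of_orthogonal μ e hem he horth (hs i)).mono_left hle
    · exact tendsto_finsetSum _ fun i _ => (hsA i).add (hsB i)
  have hfin := ge_of_tendsto' hlim hbd
  simp only [Finset.sum_const_zero, abs_zero, zero_div, zero_add, add_zero] at hfin
  rw [div_lt_iff₀ hδ] at hk
  rw [le_div_iff₀ hk0] at hfin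
  linarith

end WeaklyNull

section Separation

open Filter Topology MeasureTheory

open scoped CompactlySupported

/-- A convex cone of continuous functions none of which is everywhere negative is nonnegative
under the integral with respect to some probability measure. -/
lemma exists_isProbabilityMeasure_integral_nonneg {Ω : Type*} [TopologicalSpace Ω] [CompactSpace Ω]
    [T2Space Ω] [MeasurableSpace Ω] [BorelSpace Ω] (D : Set C(Ω, ℝ)) (hconv : Convex ℝ D)
    (h0 : 0 ∈ D) (hsmul : ∀ t : ℝ, 0 < t → ∀ d ∈ D, t • d ∈ D) (hD : ∀ d ∈ D, ∃ ω, 0 ≤ d ω) :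
    ∃ ν : Measure Ω, IsProbabilityMeasure ν ∧ ∀ d ∈ D, 0 ≤ ∫ ω, d ω ∂ν := by
  have hne : Nonempty Ω := let ⟨ω, _⟩ := hD 0 h0; ⟨ω⟩
  let S : Set C(Ω, ℝ) := {f | ∀ ω, f ω < 0}
  have hSo : IsOpen S := by
    have := ContinuousMap.isOpen_setOfPred_mapsTo (X := Ω) (Y := ℝ) isCompact_univ
      (isOpen_Iio (a := (0 : ℝ)))
    simpa [S, MapsTo] using this
  have hSc : Convex ℝ S := by
    intro f hf g hg a b ha hb hab ω
    have h1 := hf ω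
    have h2 := hg ω
    simp only [ContinuousMap.add_apply, ContinuousMap.smul_apply, smul_eq_mul]
    rcases ha.eq_or_lt with rfl | ha
    · obtain rfl : b = 1 := by linarith
      simpa using h2
    · nlinarith
  have hdisj : Disjoint S D := by
    rw [Set.disjoint_left]
    intro f hf hfD
    obtain ⟨ω, hω⟩ := hD f hfD
    exact (hf ω).not_ge hω
  obtain ⟨L, u, hLS, hLD⟩ := geometric_hahn_banach_open hSc hSo hconv hdisj
  have hu : u ≤ 0 := by simpa using hLD 0 h0
  have hL1 : 0 < L 1 := by
    have := hLS (-1) (fun ω => by simp)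
    rw [map_neg] at this
    linarith
  have hLpos : ∀ g : C(Ω, ℝ), (∀ ω, 0 ≤ g ω) → 0 ≤ L g := by
    intro g hg
    by_contra! hlt
    have := hLS (-(g + (-(L g) / L 1) • 1)) (fun ω => by
      have h1 := hg ω
      have h2 : 0 < -(L g) / L 1 := by apply div_pos <;> linarith
      simp only [ContinuousMap.neg_apply, ContinuousMap.add_apply, ContinuousMap.smul_apply,
        ContinuousMap.one_apply, smul_eq_mul, mul_one]
      linarith)
    rw [map_neg, map_add, map_smul, smul_eq_mul, div_mul_cancel₀ _ hL1.ne'] at this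
    linarith
  have hLDpos : ∀ d ∈ D, 0 ≤ L d := by
    intro d hd
    by_contra! hlt
    have h2 : 0 < (u - 1) / L d := div_pos_of_neg_of_neg (by linarith) hlt
    have := hLD _ (hsmul _ h2 d hd)
    rw [map_smul, smul_eq_mul, div_mul_cancel₀ _ hlt.ne] at this
    linarith
  let Λ : C_c(Ω, ℝ) →ₚ[ℝ] ℝ :=
    { toFun := fun g => L g.toContinuousMap
      map_add' := fun g g' => map_add L g.toContinuousMap g'.toContinuousMap
      map_smul' := fun c g => map_smul L c g.toContinuousMap
      monotone' := fun g g' hgg => by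
        have := hLpos (g'.toContinuousMap - g.toContinuousMap) (fun ω => by
          simpa using hgg ω)
        rw [map_sub] at this
        linarith }
  have hint : ∀ g : C(Ω, ℝ), ∫ ω, g ω ∂(RealRMK.rieszMeasure Λ) = L g := fun g =>
    RealRMK.integral_rieszMeasure Λ ⟨g, HasCompactSupport.of_compactSpace g⟩
  set μ := RealRMK.rieszMeasure Λ
  have hμ0 : NeZero μ := ⟨fun h => by
    have := hint 1
    rw [h] at this
    simp at this
    exact hL1.ne this⟩
  refine ⟨(μ univ)⁻¹ • μ, inferInstance, fun d hd => ?_⟩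
  rw [integral_smul_measure, hint]
  exact smul_nonneg ENNReal.toReal_nonneg (hLDpos d hd)

/-- The sign `±1` attached to a Boolean. -/
def boolSign (b : Bool) : ℝ := if b then 1 else -1

lemma abs_boolSign (b : Bool) : |boolSign b| = 1 := by cases b <;> simp [boolSign]

lemma exists_boolSign_mul_eq_abs (x : ℝ) : ∃ b, boolSign b * x = |x| := by
  rcases le_total 0 x with h | h
  · exact ⟨true, by simp [boolSign, abs_of_nonneg h]⟩
  · exact ⟨false, by simp [boolSign, abs_of_nonpos h]⟩

lemma exists_quadratic_nonneg (c : ℕ → ℕ → ℝ) (N : ℕ) : ∃ s : ℕ → Bool,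
    0 ≤ ∑ n ∈ Finset.range N, ∑ m ∈ Finset.range n, c n m * (boolSign (s n) * boolSign (s m)) := by
  induction N with
  | zero => exact ⟨fun _ => true, by simp⟩
  | succ N ih =>
    obtain ⟨s, hs⟩ := ih
    obtain ⟨b, hb⟩ := exists_boolSign_mul_eq_abs (∑ m ∈ Finset.range N, c N m * boolSign (s m))
    refine ⟨Function.update s N b, ?_⟩
    rw [Finset.sum_range_succ]
    have h1 : ∀ n ∈ Finset.range N, ∑ m ∈ Finset.range n, c n m *
        (boolSign (Function.update s N b n) * boolSign (Function.update s N b m)) =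
        ∑ m ∈ Finset.range n, c n m * (boolSign (s n) * boolSign (s m)) := by
      intro n hn
      rw [Finset.mem_range] at hn
      refine Finset.sum_congr rfl fun m hm => ?_
      rw [Finset.mem_range] at hm
      rw [Function.update_of_ne (by omega), Function.update_of_ne (by omega)]
    have h2 : ∑ m ∈ Finset.range N, c N m *
        (boolSign (Function.update s N b N) * boolSign (Function.update s N b m)) =
        |∑ m ∈ Finset.range N, c N m * boolSign (s m)| := by
      rw [← hb, Finset.mul_sum]
      refine Finset.sum_congr rfl fun m hm => ?_
      rw [Finset.mem_range] at hm
      rw [Function.update_self, Function.update_of_ne (by omega)]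
      ring
    rw [Finset.sum_congr rfl h1, h2]
    positivity

/-- If `y` dominates the unit vector basis of `ℓ¹`, then on `K × {0,1}^ℕ` there is a probability
measure for which the coordinate signs are orthogonal and correlated with `y`. -/
lemma exists_measure_orthogonal_signs {K : Type*} [TopologicalSpace K] [CompactSpace K] [T2Space K]
    [MeasurableSpace (K × (ℕ → Bool))] [BorelSpace (K × (ℕ → Bool))] (y : ℕ → C(K, ℝ)) {δ : ℝ}
    (hδ : 0 < δ) (hy : ∀ (L : ℕ) (a : ℕ → ℝ), δ * ∑ i ∈ Finset.range L, |a i| ≤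
      ‖∑ i ∈ Finset.range L, a i • y i‖) :
    ∃ ν : Measure (K × (ℕ → Bool)), IsProbabilityMeasure ν ∧
      (∀ m n, m < n → ∫ ω, boolSign (ω.2 n) * boolSign (ω.2 m) ∂ν = 0) ∧
      ∀ n, δ ≤ ∫ ω, boolSign (ω.2 n) * y n ω.1 ∂ν := by
  have hK : Nonempty K := by
    by_contra! h
    have h1 := hy 1 1
    rw [Subsingleton.elim (∑ i ∈ Finset.range 1, (1 : ℕ → ℝ) i • y i) 0, norm_zero] at h1
    simp at h1
    linarith
  have hsc : ∀ n, Continuous fun ω : K × (ℕ → Bool) => boolSign (ω.2 n) := fun n =>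
    (continuous_of_discreteTopology (f := boolSign)).comp
      ((continuous_apply n).comp continuous_snd)
  let Q : ℕ → (ℕ → ℝ) → (ℕ → ℕ → ℝ) → K × (ℕ → Bool) → ℝ := fun N a c ω =>
    ∑ n ∈ Finset.range N, (a n * (boolSign (ω.2 n) * y n ω.1 - δ) +
      ∑ m ∈ Finset.range n, c n m * (boolSign (ω.2 n) * boolSign (ω.2 m)))
  have hQadd : ∀ N a c a' c' ω, Q N (a + a') (c + c') ω = Q N a c ω + Q N a' c' ω := by
    intro N a c a' c' ω
    simp only [Q, Pi.add_apply, add_mul, Finset.sum_add_distrib]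
    ring
  have hQsmul : ∀ N a c (t : ℝ) ω, Q N (t • a) (t • c) ω = t * Q N a c ω := by
    intro N a c t ω
    simp only [Q, Pi.smul_apply, smul_eq_mul, Finset.mul_sum, mul_add, mul_assoc]
  let D : Set C(K × (ℕ → Bool), ℝ) :=
    {d | ∃ N₀ a c, (∀ n, 0 ≤ a n) ∧ ∀ N, N₀ ≤ N → ∀ ω, d ω = Q N a c ω}
  have hsmul : ∀ t : ℝ, 0 ≤ t → ∀ d ∈ D, t • d ∈ D := by
    rintro t ht d ⟨N₀, a, c, ha, h⟩
    refine ⟨N₀, t • a, t • c, fun n => mul_nonneg ht (ha n), fun N hN ω => ?_⟩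
    rw [hQsmul, ← h N hN]
    simp
  have hadd : ∀ d ∈ D, ∀ d' ∈ D, d + d' ∈ D := by
    rintro d ⟨N₀, a, c, ha, h⟩ d' ⟨N₁, a', c', ha', h'⟩
    refine ⟨max N₀ N₁, a + a', c + c', fun n => add_nonneg (ha n) (ha' n), fun N hN ω => ?_⟩
    rw [hQadd, ← h N (le_trans (le_max_left _ _) hN), ← h' N (le_trans (le_max_right _ _) hN)]
    simp
  have hD : ∀ d ∈ D, ∃ ω, 0 ≤ d ω := by
    rintro d ⟨N, a, c, ha, h⟩
    obtain ⟨s, hs⟩ := exists_quadratic_nonneg c N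
    have h1 := hy N (fun n => a n * boolSign (s n))
    simp only [abs_mul, abs_boolSign, mul_one, abs_of_nonneg (ha _)] at h1
    obtain ⟨t, ht⟩ : ∃ t, ‖∑ n ∈ Finset.range N, (a n * boolSign (s n)) • y n‖ ≤
        |(∑ n ∈ Finset.range N, (a n * boolSign (s n)) • y n) t| := by
      set f := ∑ n ∈ Finset.range N, (a n * boolSign (s n)) • y n
      obtain ⟨t, -, ht⟩ := isCompact_univ.exists_isMaxOn (s := (univ : Set K)) univ_nonempty
        (f := fun t => |f t|) (by fun_prop)
      exact ⟨t, (ContinuousMap.norm_le _ (abs_nonneg _)).2 fun x => ht (mem_univ x)⟩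
    have h2 := h1.trans ht
    obtain ⟨b, hb⟩ := exists_boolSign_mul_eq_abs
      ((∑ n ∈ Finset.range N, (a n * boolSign (s n)) • y n) t)
    rw [← hb] at h2
    refine ⟨(t, fun n => if b then s n else !(s n)), ?_⟩
    rw [h N le_rfl]
    have h3 : ∀ n, boolSign (if b then s n else !(s n)) = boolSign b * boolSign (s n) := by
      intro n
      cases b <;> cases s n <;> simp [boolSign]
    have h4 : boolSign b * boolSign b = 1 := by cases b <;> simp [boolSign]
    simp only [Q, h3, Finset.sum_add_distrib]
    have h5 : ∑ n ∈ Finset.range N, ∑ m ∈ Finset.range n,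
        c n m * (boolSign b * boolSign (s n) * (boolSign b * boolSign (s m))) =
        ∑ n ∈ Finset.range N, ∑ m ∈ Finset.range n, c n m * (boolSign (s n) * boolSign (s m)) := by
      refine Finset.sum_congr rfl fun n _ => Finset.sum_congr rfl fun m _ => ?_
      linear_combination (c n m * boolSign (s n) * boolSign (s m)) * h4
    rw [h5]
    refine add_nonneg ?_ hs
    simp only [mul_sub, Finset.sum_sub_distrib, ← Finset.sum_mul]
    rw [sub_nonneg, mul_comm]
    refine h2.trans_eq ?_
    simp only [ContinuousMap.sum_apply, ContinuousMap.smul_apply, smul_eq_mul, Finset.mul_sum]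
    exact Finset.sum_congr rfl fun n _ => by ring
  obtain ⟨ν, hν, hνD⟩ := exists_isProbabilityMeasure_integral_nonneg D
    (fun d hd d' hd' s t hs ht _ => hadd _ (hsmul s hs d hd) _ (hsmul t ht d' hd'))
    ⟨0, 0, 0, fun _ => le_rfl, fun N _ ω => by simp [Q]⟩ (fun t ht => hsmul t ht.le) hD
  refine ⟨ν, hν, fun m n hmn => ?_, fun n => ?_⟩
  · have key : ∀ r : ℝ, 0 ≤ r * ∫ ω, boolSign (ω.2 n) * boolSign (ω.2 m) ∂ν := by
      intro r
      rw [← integral_const_mul]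
      refine hνD ⟨fun ω => r * (boolSign (ω.2 n) * boolSign (ω.2 m)),
        continuous_const.mul ((hsc n).mul (hsc m))⟩
        ⟨n + 1, 0, Pi.single n (Pi.single m r), fun _ => le_rfl, fun N hN ω => ?_⟩
      simp only [Q, ContinuousMap.coe_mk, Pi.zero_apply, zero_mul, zero_add]
      rw [Finset.sum_eq_single n, Finset.sum_eq_single m]
      · simp
      · intro b _ hb
        simp [hb]
      · intro h
        exact absurd (Finset.mem_range.2 hmn) h
      · intro b _ hb
        simp [hb]
      · intro h
        exact absurd (Finset.mem_range.2 (by omega)) h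
    have h1 := key 1
    have h2 := key (-1)
    linarith
  · have := hνD ⟨fun ω => boolSign (ω.2 n) * y n ω.1 - δ,
        ((hsc n).mul ((y n).continuous.comp continuous_fst)).sub continuous_const⟩
        ⟨n + 1, Pi.single n 1, 0, fun k => ?_, fun N hN ω => ?_⟩
    · simp only [ContinuousMap.coe_mk] at this
      rw [integral_sub _ (integrable_const _)] at this
      · simp at this
        exact this
      · exact (((hsc n).mul ((y n).continuous.comp
          continuous_fst)).integrable_of_hasCompactSupport (HasCompactSupport.of_compactSpace _))
    · by_cases h : k = n
      · subst h; simp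
      · simp [h]
    · simp only [Q, ContinuousMap.coe_mk, Pi.zero_apply, zero_mul, Finset.sum_const_zero,
        add_zero]
      rw [Finset.sum_eq_single n]
      · simp
      · intro b _ hb
        simp [hb]
      · intro h
        exact absurd (Finset.mem_range.2 (by omega)) h

end Separation

section FinitelySupported

open Filter Topology MeasureTheory

/-- The `ℓ¹` norm on finitely supported functions, as a seminorm. -/
noncomputable def l1Seminorm (Γ : Type*) : Seminorm ℝ (Γ →₀ ℝ) :=
  Seminorm.of (fun x => x.sum fun _ r => |r|)
    (fun x y => by
      classical
      rw [Finsupp.sum_of_support_subset (x + y) Finsupp.support_add _ (by simp),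
        Finsupp.sum_of_support_subset x Finset.subset_union_left _ (by simp),
        Finsupp.sum_of_support_subset y Finset.subset_union_right _ (by simp),
        ← Finset.sum_add_distrib]
      exact Finset.sum_le_sum fun γ _ => abs_add_le _ _)
    (fun c x => by
      rw [Finsupp.sum_smul_index (by simp), Finsupp.sum, Finsupp.sum, Finset.mul_sum]
      exact Finset.sum_congr rfl fun γ _ => abs_mul _ _)

lemma l1Seminorm_apply {Γ : Type*} (x : Γ →₀ ℝ) : l1Seminorm Γ x = ∑ γ ∈ x.support, |x γ| := rfl

/-- If combinations of functions from a family in `[0,1]`, with bounded `ℓ¹` norms, dominate the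
unit vector basis of `ℓ¹`, then the family contains an independent sequence. -/
lemma exists_isIndependentSeq_of_linearCombination {K Γ : Type*} [TopologicalSpace K]
    [CompactSpace K] [T2Space K] (f : Γ → C(K, ℝ)) (hf : ∀ γ t, f γ t ∈ Icc (0 : ℝ) 1)
    (y : ℕ → Γ →₀ ℝ) {R δ : ℝ} (hR : ∀ n, l1Seminorm Γ (y n) ≤ R) (hδ : 0 < δ)
    (hy : ∀ (L : ℕ) (a : ℕ → ℝ), δ * ∑ i ∈ Finset.range L, |a i| ≤
      ‖∑ i ∈ Finset.range L, a i • Finsupp.linearCombination ℝ f (y i)‖) :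
    ∃ p q : ℝ, p < q ∧ ∃ φ : ℕ → Γ,
      IsIndependentSeq (fun n => {t | f (φ n) t < p}) (fun n => {t | f (φ n) t > q}) := by
  let _ : MeasurableSpace (K × (ℕ → Bool)) := borel _
  have : BorelSpace (K × (ℕ → Bool)) := ⟨rfl⟩
  obtain ⟨ν, hν, horth, hcorr⟩ := exists_measure_orthogonal_signs _ hδ hy
  have hsc : ∀ n, Continuous fun ω : K × (ℕ → Bool) => boolSign (ω.2 n) := fun n =>
    (continuous_of_discreteTopology (f := boolSign)).comp
      ((continuous_apply n).comp continuous_snd)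
  have hfc : ∀ γ, Continuous fun ω : K × (ℕ → Bool) => f γ ω.1 := fun γ =>
    (f γ).continuous.comp continuous_fst
  have hR0 : 0 ≤ R := (apply_nonneg _ _).trans (hR 0)
  have hsel : ∀ n, ∃ γ, δ / (R + 1) ≤ |∫ ω, boolSign (ω.2 n) * f γ ω.1 ∂ν| := by
    intro n
    by_contra! hlt
    have h1 : ∫ ω, boolSign (ω.2 n) * Finsupp.linearCombination ℝ f (y n) ω.1 ∂ν =
        ∑ γ ∈ (y n).support, y n γ * ∫ ω, boolSign (ω.2 n) * f γ ω.1 ∂ν := by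
      simp_rw [← integral_const_mul]
      rw [← integral_finsetSum]
      · congr 1 with ω
        simp only [Finsupp.linearCombination_apply, Finsupp.sum, ContinuousMap.sum_apply,
          ContinuousMap.smul_apply, smul_eq_mul, Finset.mul_sum]
        exact Finset.sum_congr rfl fun _ _ => by ring
      · exact fun γ _ => (continuous_const.mul ((hsc n).mul
          (hfc γ))).integrable_of_hasCompactSupport (HasCompactSupport.of_compactSpace _)
    have h2 := hcorr n
    rw [h1] at h2
    have h3 : ∑ γ ∈ (y n).support, y n γ * ∫ ω, boolSign (ω.2 n) * f γ ω.1 ∂ν ≤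
        R * (δ / (R + 1)) := by
      calc _ ≤ ∑ γ ∈ (y n).support, |y n γ| * (δ / (R + 1)) := by
            refine Finset.sum_le_sum fun γ _ => (le_abs_self _).trans ?_
            rw [abs_mul]
            exact mul_le_mul_of_nonneg_left (hlt γ).le (abs_nonneg _)
        _ = l1Seminorm Γ (y n) * (δ / (R + 1)) := by rw [← Finset.sum_mul, l1Seminorm_apply]
        _ ≤ R * (δ / (R + 1)) := by
            have := hR n
            gcongr
    have h4 : R * (δ / (R + 1)) < δ := by
      rw [mul_div_assoc', div_lt_iff₀ (by linarith)]
      nlinarith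
    linarith
  choose γ hγ using hsel
  obtain ⟨p, q, hpq, φ, hφ⟩ := exists_isIndependentSeq_of_orthogonal ν
    (fun n ω => boolSign (ω.2 n)) (fun n ω => f (γ n) ω.1) (fun n => (hsc n).measurable)
    (fun n ω => abs_boolSign _) horth (fun n => (hfc _).measurable) (fun n ω => hf _ _)
    (by positivity) hγ
  refine ⟨p, q, hpq, γ ∘ φ, fun n ε => ?_⟩
  obtain ⟨ω, hω⟩ := hφ n ε
  refine ⟨ω.1, ?_⟩
  rw [mem_iInter] at hω ⊢
  intro k
  have := hω k
  split_ifs at this ⊢ <;> exact this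

end FinitelySupported

section Interpolation

open Filter Topology
open scoped NNReal

variable {V : Type*} [AddCommGroup V] [Module ℝ V]

/-- The seminorms interpolating between `p` and `q` at the scale `2 ^ k`. -/
noncomputable def interpSeminorm (p q : Seminorm ℝ V) (k : ℕ) : Seminorm ℝ V :=
  ((2 ^ k : ℝ≥0)⁻¹ • p) ⊓ ((2 ^ k : ℝ≥0) • q)

/-- The supremum of the interpolating seminorms. -/
noncomputable def supInterpSeminorm (p q : Seminorm ℝ V) : Seminorm ℝ V :=
  ⨆ k, interpSeminorm p q k

lemma interpSeminorm_le_left (p q : Seminorm ℝ V) (k : ℕ) (x : V) :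
    interpSeminorm p q k x ≤ (2 ^ k)⁻¹ * p x :=
  (inf_le_left : interpSeminorm p q k ≤ _) x

lemma interpSeminorm_le_right (p q : Seminorm ℝ V) (k : ℕ) (x : V) :
    interpSeminorm p q k x ≤ 2 ^ k * q x :=
  (inf_le_right : interpSeminorm p q k ≤ _) x

lemma interpSeminorm_le (p q : Seminorm ℝ V) (k : ℕ) (x : V) : interpSeminorm p q k x ≤ p x := by
  refine (interpSeminorm_le_left p q k x).trans (mul_le_of_le_one_left (apply_nonneg p x) ?_)
  exact inv_le_one_of_one_le₀ (one_le_pow₀ one_le_two)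

lemma bddAbove_interpSeminorm (p q : Seminorm ℝ V) : BddAbove (range (interpSeminorm p q)) :=
  ⟨p, by rintro _ ⟨k, rfl⟩; exact interpSeminorm_le p q k⟩

lemma supInterpSeminorm_apply (p q : Seminorm ℝ V) (x : V) :
    supInterpSeminorm p q x = ⨆ k, interpSeminorm p q k x :=
  Seminorm.iSup_apply (bddAbove_interpSeminorm p q)

lemma interpSeminorm_le_sup (p q : Seminorm ℝ V) (k : ℕ) (x : V) :
    interpSeminorm p q k x ≤ supInterpSeminorm p q x :=
  (le_ciSup (bddAbove_interpSeminorm p q) k : interpSeminorm p q k ≤ _) x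

lemma supInterpSeminorm_le {p q : Seminorm ℝ V} {x : V} {C : ℝ}
    (h : ∀ k, interpSeminorm p q k x ≤ C) : supInterpSeminorm p q x ≤ C := by
  rw [supInterpSeminorm_apply]
  exact ciSup_le h

lemma le_supInterpSeminorm {p q : Seminorm ℝ V} (hqp : q ≤ p) : q ≤ supInterpSeminorm p q := by
  refine le_trans ?_ (le_ciSup (bddAbove_interpSeminorm p q) 0)
  simp [interpSeminorm, hqp]

lemma Seminorm.sum_smul_le {ι : Type*} (p : Seminorm ℝ V) (s : Finset ι) (a : ι → ℝ) (x : ι → V)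
    {C : ℝ} (hC : ∀ i, p (x i) ≤ C) : p (∑ i ∈ s, a i • x i) ≤ (∑ i ∈ s, |a i|) * C := by
  refine (Finset.le_sum_of_subadditive p (map_zero p).le (map_add_le_add p) s
    fun i => a i • x i).trans ?_
  rw [Finset.sum_mul]
  refine Finset.sum_le_sum fun i _ => ?_
  rw [map_smul_eq_mul, Real.norm_eq_abs]
  exact mul_le_mul_of_nonneg_left (hC i) (abs_nonneg _)

/-- If no sequence bounded for `p` spans `ℓ¹` for `q`, then sequences bounded for the
interpolation have normalized combinations that are small for `q`. -/
lemma exists_sum_abs_eq_one_le {p q : Seminorm ℝ V}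
    (H : ∀ (y : ℕ → V) (R δ : ℝ), (∀ n, p (y n) ≤ R) → 0 < δ → ∃ (L : ℕ) (a : ℕ → ℝ),
      q (∑ i ∈ Finset.range L, a i • y i) < δ * ∑ i ∈ Finset.range L, |a i|)
    (x : ℕ → V) {C ε : ℝ} (hx : ∀ n, supInterpSeminorm p q (x n) ≤ C) (hε : 0 < ε) :
    ∃ (L : ℕ) (a : ℕ → ℝ), ∑ i ∈ Finset.range L, |a i| = 1 ∧
      q (∑ i ∈ Finset.range L, a i • x i) ≤ ε := by
  have hC : 0 ≤ C := (apply_nonneg _ _).trans (hx 0)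
  obtain ⟨k, hk⟩ := pow_unbounded_of_one_lt ((C + 1) / (ε / 2)) one_lt_two
  rw [div_lt_iff₀ (by positivity)] at hk
  have hsplit : ∀ n, ∃ u, (2 ^ k)⁻¹ * p u + 2 ^ k * q (x n - u) < C + 1 := by
    intro n
    have h1 : interpSeminorm p q k (x n) < C + 1 := by
      linarith [interpSeminorm_le_sup p q k (x n), hx n]
    rw [interpSeminorm, Seminorm.inf_apply] at h1
    exact exists_lt_of_ciInf_lt h1
  choose y hy using hsplit
  have hk0 : (0 : ℝ) < 2 ^ k := by positivity
  have hyp : ∀ n, p (y n) ≤ 2 ^ k * (C + 1) := by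
    intro n
    have h1 : 0 ≤ 2 ^ k * q (x n - y n) := by positivity
    have h2 : (2 ^ k)⁻¹ * p (y n) ≤ C + 1 := by linarith [hy n]
    rwa [inv_mul_le_iff₀ hk0] at h2
  have hyq : ∀ n, q (x n - y n) ≤ ε / 2 := by
    intro n
    have h1 : 0 ≤ (2 ^ k)⁻¹ * p (y n) := by positivity
    have h2 : 2 ^ k * q (x n - y n) ≤ 2 ^ k * (ε / 2) := by linarith [hy n]
    exact le_of_mul_le_mul_left h2 hk0
  obtain ⟨L, a, ha⟩ := H y _ (ε / 2) hyp (by positivity)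
  set A := ∑ i ∈ Finset.range L, |a i| with hA
  have hA0 : 0 < A := by
    by_contra! h
    have : ε / 2 * A ≤ 0 := mul_nonpos_of_nonneg_of_nonpos (by positivity) h
    linarith [apply_nonneg q (∑ i ∈ Finset.range L, a i • y i)]
  have hsum : q (∑ i ∈ Finset.range L, a i • x i) ≤ ε * A := by
    have h1 : ∑ i ∈ Finset.range L, a i • x i =
        ∑ i ∈ Finset.range L, a i • y i + ∑ i ∈ Finset.range L, a i • (x i - y i) := by
      simp [smul_sub]
    have h2 := q.sum_smul_le (Finset.range L) a (fun i => x i - y i) hyq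
    rw [h1]
    refine (map_add_le_add q _ _).trans ?_
    rw [← hA] at h2
    linarith
  refine ⟨L, fun i => A⁻¹ * a i, ?_, ?_⟩
  · simp_rw [abs_mul, ← Finset.mul_sum, abs_of_pos (inv_pos.2 hA0)]
    exact inv_mul_cancel₀ hA0.ne'
  · simp_rw [mul_smul, ← Finset.smul_sum]
    rw [map_smul_eq_mul, Real.norm_eq_abs, abs_of_pos (inv_pos.2 hA0), inv_mul_le_iff₀ hA0]
    linarith

/-- No sequence bounded for the interpolation spans `ℓ¹` for the interpolation. -/
lemma exists_supInterpSeminorm_sum_lt {p q : Seminorm ℝ V}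
    (H : ∀ (y : ℕ → V) (R δ : ℝ), (∀ n, p (y n) ≤ R) → 0 < δ → ∃ (L : ℕ) (a : ℕ → ℝ),
      q (∑ i ∈ Finset.range L, a i • y i) < δ * ∑ i ∈ Finset.range L, |a i|)
    (x : ℕ → V) {C c : ℝ} (hx : ∀ n, supInterpSeminorm p q (x n) ≤ C) (hc : 0 < c) :
    ∃ (L : ℕ) (a : ℕ → ℝ), supInterpSeminorm p q (∑ i ∈ Finset.range L, a i • x i) <
      c * ∑ i ∈ Finset.range L, |a i| := by
  have hC : 0 ≤ C := (apply_nonneg _ _).trans (hx 0)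
  have key : ∀ (m : ℕ) (ε : ℝ), 0 < ε → ∃ (L : ℕ) (a : ℕ → ℝ),
      ∑ i ∈ Finset.range L, |a i| = m ∧
      supInterpSeminorm p q (∑ i ∈ Finset.range L, a i • x i) ≤ C + ε := by
    intro m
    induction m with
    | zero => exact fun ε hε => ⟨0, 0, by simp, by simp; linarith⟩
    | succ m ih =>
      intro ε hε
      obtain ⟨L, a, ha, hs⟩ := ih (ε / 2) (by positivity)
      set s := ∑ i ∈ Finset.range L, a i • x i with hs_def
      obtain ⟨M, hM⟩ := pow_unbounded_of_one_lt (p s / (ε / 2)) one_lt_two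
      rw [div_lt_iff₀ (by positivity)] at hM
      obtain ⟨L', a', ha', hs'⟩ := exists_sum_abs_eq_one_le H (fun n => x (L + n))
        (ε := (2 ^ M)⁻¹ * (ε / 2)) (fun n => hx (L + n)) (by positivity)
      set s' := ∑ i ∈ Finset.range L', a' i • x (L + i) with hs'_def
      have hPs' : supInterpSeminorm p q s' ≤ C := by
        have := (supInterpSeminorm p q).sum_smul_le (Finset.range L') a' (fun n => x (L + n))
          (fun n => hx (L + n))
        rwa [ha', one_mul] at this
      refine ⟨L + L', fun i => if i < L then a i else a' (i - L), ?_, ?_⟩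
      · rw [Finset.sum_range_add, Nat.cast_succ, ← ha, ← ha']
        congr 1
        · exact Finset.sum_congr rfl fun i hi => by simp [Finset.mem_range.1 hi]
        · simp
      · have h1 : ∑ i ∈ Finset.range (L + L'), (if i < L then a i else a' (i - L)) • x i =
            s + s' := by
          rw [Finset.sum_range_add]
          congr 1
          · exact Finset.sum_congr rfl fun i hi => by simp [Finset.mem_range.1 hi]
          · simp [hs'_def]
        rw [h1]
        refine supInterpSeminorm_le fun k => (map_add_le_add _ _ _).trans ?_
        rcases lt_or_ge k M with hk | hk
        · have h2 := interpSeminorm_le_right p q k s'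
          have h3 : (2 : ℝ) ^ k * q s' ≤ ε / 2 := by
            have h4 : (2 : ℝ) ^ k ≤ 2 ^ M := pow_le_pow_right₀ one_le_two hk.le
            calc (2 : ℝ) ^ k * q s' ≤ 2 ^ M * ((2 ^ M)⁻¹ * (ε / 2)) := by gcongr
              _ = ε / 2 := by field_simp
          linarith [interpSeminorm_le_sup p q k s]
        · have h2 := interpSeminorm_le_left p q k s
          have h3 : ((2 : ℝ) ^ k)⁻¹ * p s ≤ ε / 2 := by
            rw [inv_mul_le_iff₀ (by positivity)]
            have h4 : (2 : ℝ) ^ M ≤ 2 ^ k := pow_le_pow_right₀ one_le_two hk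
            exact hM.le.trans (by gcongr)
          linarith [interpSeminorm_le_sup p q k s']
  by_contra! h
  obtain ⟨m, hm⟩ := exists_nat_gt ((C + 1) / c)
  rw [div_lt_iff₀ hc] at hm
  obtain ⟨L, a, ha, hs⟩ := key m 1 one_pos
  have := h L a
  rw [ha] at this
  linarith

end Interpolation

section Completion

/-- If the completion of a seminormed space contains `ℓ¹`, then the space contains a bounded
sequence that dominates the unit vector basis of `ℓ¹`. -/
lemma ContainsL1.exists_seq {V : Type*} [SeminormedAddCommGroup V] [NormedSpace ℝ V]
    (h : ContainsL1 (UniformSpace.Completion V)) : ∃ (x : ℕ → V) (C c : ℝ), 0 < c ∧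
      (∀ n, ‖x n‖ ≤ C) ∧ ∀ (L : ℕ) (a : ℕ → ℝ),
        c * ∑ i ∈ Finset.range L, |a i| ≤ ‖∑ i ∈ Finset.range L, a i • x i‖ := by
  obtain ⟨T, c, hc, hT⟩ := h
  let e : ℕ → lp (fun _ : ℕ => ℝ) 1 := fun n => lp.single 1 n (1 : ℝ)
  have he : ∀ n, ‖e n‖ = 1 := fun n => by simp [e, lp.norm_single]
  have hd : ∀ n, ∃ v : V, ‖(v : UniformSpace.Completion V) - T (e n)‖ ≤ c / 2 := by
    intro n
    obtain ⟨v, hv⟩ := (UniformSpace.Completion.denseRange_coe (α := V)).exists_dist_lt (T (e n))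
      (half_pos hc)
    rw [dist_comm, dist_eq_norm] at hv
    exact ⟨v, hv.le⟩
  choose x hx using hd
  refine ⟨x, ‖T‖ + c / 2, c / 2, by positivity, fun n => ?_, fun L a => ?_⟩
  · rw [← UniformSpace.Completion.norm_coe]
    have h1 := norm_le_norm_add_norm_sub' (x n : UniformSpace.Completion V) (T (e n))
    have h2 := T.le_opNorm (e n)
    rw [he, mul_one] at h2
    linarith [hx n]
  · have h1 : ‖∑ i ∈ Finset.range L, a i • e i‖ = ∑ i ∈ Finset.range L, |a i| := by
      have := lp.norm_sum_single (p := 1) (E := fun _ : ℕ => ℝ) (by simp) a (Finset.range L)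
      simp only [ENNReal.toReal_one, Real.rpow_one, Real.norm_eq_abs] at this
      rw [← this]
      congr 1
      refine Finset.sum_congr rfl fun i _ => ?_
      rw [← lp.single_smul, smul_eq_mul, mul_one]
    have h2 := hT (∑ i ∈ Finset.range L, a i • e i)
    rw [h1, map_sum] at h2
    simp_rw [map_smul] at h2
    have h3 : ((∑ i ∈ Finset.range L, a i • x i : V) : UniformSpace.Completion V) =
        ∑ i ∈ Finset.range L, a i • (x i : UniformSpace.Completion V) := by
      refine (map_sum (UniformSpace.Completion.toComplₗᵢ : V →ₗᵢ[ℝ] _) (fun i => a i • x i)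
        (Finset.range L)).trans ?_
      exact Finset.sum_congr rfl fun i _ => UniformSpace.Completion.coe_smul _ _
    have h4 := (normSeminorm ℝ (UniformSpace.Completion V)).sum_smul_le (Finset.range L) a
      (fun i => (x i : UniformSpace.Completion V) - T (e i)) hx
    simp only [coe_normSeminorm, smul_sub, Finset.sum_sub_distrib] at h4
    rw [← UniformSpace.Completion.norm_coe, h3]
    have h5 := norm_le_norm_add_norm_sub (∑ i ∈ Finset.range L, a i • T (e i))
      (∑ i ∈ Finset.range L, a i • (x i : UniformSpace.Completion V))
    rw [norm_sub_rev] at h4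
    have h6 := norm_sub_norm_le (∑ i ∈ Finset.range L, a i • T (e i))
      (∑ i ∈ Finset.range L, a i • (x i : UniformSpace.Completion V))
    linarith

/-- A linear map dominated by a seminorm without `ℓ¹`-sequences factors through a Banach space
not containing `ℓ¹`. -/
lemma exists_factorization_not_containsL1 {V : Type} [AddCommGroup V] [Module ℝ V]
    (P : Seminorm ℝ V) {E : Type*} [NormedAddCommGroup E] [NormedSpace ℝ E] [CompleteSpace E]
    (J : V →ₗ[ℝ] E) (hJ : ∀ x, ‖J x‖ ≤ P x)
    (hP : ∀ (x : ℕ → V) (C c : ℝ), (∀ n, P (x n) ≤ C) → 0 < c → ∃ (L : ℕ) (a : ℕ → ℝ),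
      P (∑ i ∈ Finset.range L, a i • x i) < c * ∑ i ∈ Finset.range L, |a i|) :
    ∃ (X : Type) (_ : NormedAddCommGroup X) (_ : NormedSpace ℝ X) (_ : CompleteSpace X)
      (T : X →L[ℝ] E), ¬ ContainsL1 X ∧ ∀ v, ∃ x, T x = J v := by
  let _ : SeminormedAddCommGroup V := P.toAddGroupSeminorm.toSeminormedAddCommGroup
  let _ : NormedSpace ℝ V := { norm_smul_le := fun a b => (map_smul_eq_mul P a b).le }
  let e : V →ₗ[ℝ] UniformSpace.Completion V :=
    (UniformSpace.Completion.toComplL : V →L[ℝ] UniformSpace.Completion V)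
  refine ⟨UniformSpace.Completion V, inferInstance, inferInstance, inferInstance,
    J.extendOfNorm e, fun h => ?_, fun v => ⟨e v, LinearMap.extendOfNorm_eq
      UniformSpace.Completion.denseRange_coe ⟨1, fun x => ?_⟩ v⟩⟩
  · obtain ⟨x, C, c, hc, hx, hlow⟩ := h.exists_seq
    obtain ⟨L, a, ha⟩ := hP x C c hx hc
    exact (hlow L a).not_gt ha
  · rw [one_mul]
    exact (hJ x).trans_eq (UniformSpace.Completion.norm_coe x).symm

end Completion

section Main

open Filter Topology

/-- A bounded sequence of a Banach space dominating the unit vector basis of `ℓ¹` spans a copy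
of `ℓ¹`. -/
lemma ContainsL1.of_seq {X : Type*} [NormedAddCommGroup X] [NormedSpace ℝ X] [CompleteSpace X]
    (x : ℕ → X) (hx : ∀ n, ‖x n‖ ≤ 1) {c : ℝ} (hc : 0 < c)
    (h : ∀ (L : ℕ) (a : ℕ → ℝ),
      c * ∑ i ∈ Finset.range L, |a i| ≤ ‖∑ i ∈ Finset.range L, a i • x i‖) : ContainsL1 X := by
  have hn : ∀ v : lp (fun _ : ℕ => ℝ) 1, HasSum (fun n => |v n|) ‖v‖ := fun v => by
    simpa using lp.hasSum_norm (p := 1) (by simp) v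
  have hle : ∀ (v : lp (fun _ : ℕ => ℝ) 1) n, ‖v n • x n‖ ≤ |v n| := fun v n => by
    rw [norm_smul, Real.norm_eq_abs]
    exact mul_le_of_le_one_right (abs_nonneg _) (hx n)
  have hs : ∀ v : lp (fun _ : ℕ => ℝ) 1, Summable fun n => v n • x n := fun v =>
    (hn v).summable.of_norm_bounded (hle v)
  let T : lp (fun _ : ℕ => ℝ) 1 →ₗ[ℝ] X :=
    { toFun := fun v => ∑' n, v n • x n
      map_add' := fun v w => by
        rw [← (hs v).tsum_add (hs w)]
        exact tsum_congr fun n => by rw [lp.coeFn_add, Pi.add_apply, add_smul]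
      map_smul' := fun r v => by
        rw [RingHom.id_apply, ← (hs v).tsum_const_smul r]
        exact tsum_congr fun n => by rw [lp.coeFn_smul, Pi.smul_apply, smul_assoc] }
  refine ⟨T.mkContinuous 1 fun v => ?_, c, hc, fun v => ?_⟩
  · rw [one_mul]
    exact tsum_of_norm_bounded (hn v) (hle v)
  · exact le_of_tendsto_of_tendsto' ((hn v).tendsto_sum_nat.const_mul c)
      (hs v).hasSum.tendsto_sum_nat.norm fun L => h L v

/-- A weak*-compact subset of the dual of a Banach space is norm bounded. -/
lemma WeakDual.exists_norm_apply_le_of_isCompact {X : Type*} [NormedAddCommGroup X]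
    [NormedSpace ℝ X] [CompleteSpace X] {S : Set (WeakDual ℝ X)} (hS : IsCompact S) :
    ∃ M : ℝ, 1 ≤ M ∧ ∀ s ∈ S, ∀ x : X, |s x| ≤ M * ‖x‖ := by
  obtain ⟨C, hC⟩ := banach_steinhaus (g := fun s : S => WeakDual.toStrongDual s.1) (fun x => by
    obtain ⟨C, hC⟩ := hS.exists_bound_of_continuousOn (WeakDual.eval_continuous x).continuousOn
    exact ⟨C, fun s => hC s.1 s.2⟩)
  refine ⟨max C 1, le_max_right _ _, fun s hs x => ?_⟩
  refine ((WeakDual.toStrongDual s).le_opNorm x).trans ?_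
  gcongr
  exact (hC ⟨s, hs⟩).trans (le_max_left _ _)

/-- An independent sequence of pairs of level sets of evaluations on a bounded set of functionals
yields a copy of `ℓ¹`. -/
lemma ContainsL1.of_isIndependentSeq {X K : Type*} [NormedAddCommGroup X] [NormedSpace ℝ X]
    [CompleteSpace X] (g : K → X →L[ℝ] ℝ) (hg : ∀ t x, |g t x| ≤ ‖x‖) (x : ℕ → X)
    (hx : ∀ n, ‖x n‖ ≤ 1) {p q : ℝ} (hpq : p < q)
    (h : IsIndependentSeq (fun n => {t | g t (x n) < p}) (fun n => {t | g t (x n) > q})) :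
    ContainsL1 X := by
  refine ContainsL1.of_seq x hx (c := (q - p) / 2) (by linarith) fun L a => ?_
  obtain ⟨t₁, h₁⟩ := h L (fun k => decide (0 ≤ a k))
  obtain ⟨t₂, h₂⟩ := h L (fun k => !decide (0 ≤ a k))
  rw [mem_iInter] at h₁ h₂
  have key : (q - p) * ∑ i ∈ Finset.range L, |a i| ≤
      g t₁ (∑ i ∈ Finset.range L, a i • x i) - g t₂ (∑ i ∈ Finset.range L, a i • x i) := by
    rw [map_sum, map_sum, ← Finset.sum_sub_distrib, Finset.mul_sum]
    refine Finset.sum_le_sum fun i hi => ?_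
    have h₁i := h₁ ⟨i, Finset.mem_range.1 hi⟩
    have h₂i := h₂ ⟨i, Finset.mem_range.1 hi⟩
    simp only [map_smul, smul_eq_mul]
    by_cases hai : 0 ≤ a i
    · simp [hai] at h₁i h₂i
      rw [abs_of_nonneg hai]
      nlinarith
    · simp [hai] at h₁i h₂i
      rw [abs_of_neg (not_le.1 hai)]
      nlinarith
  have h3 := (abs_le.1 (hg t₁ (∑ i ∈ Finset.range L, a i • x i))).2
  have h4 := (abs_le.1 (hg t₂ (∑ i ∈ Finset.range L, a i • x i))).1
  linarith

lemma IsWRN.exists_embedding {K : Type*} [TopologicalSpace K] [CompactSpace K] (h : IsWRN K) :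
    ∃ (Γ : Type) (i : K → Γ → unitInterval), Topology.IsEmbedding i ∧
      ∀ p q : ℝ, p < q →
        ¬ ∃ φ : ℕ → Γ, IsIndependentSeq
            (fun n => {x : K | (i x (φ n) : ℝ) < p})
            (fun n => {x : K | (i x (φ n) : ℝ) > q}) := by
  obtain ⟨X, _, _, _, S, hX, hS, ⟨e⟩⟩ := h
  obtain ⟨M, hM1, hM⟩ := WeakDual.exists_norm_apply_le_of_isCompact hS
  have hM0 : 0 < M := by linarith
  let g : K → X →L[ℝ] ℝ := fun t => M⁻¹ • WeakDual.toStrongDual (e t).1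
  have hgapp : ∀ t x, g t x = M⁻¹ * (e t).1 x := fun t x => rfl
  have hg : ∀ t x, |g t x| ≤ ‖x‖ := by
    intro t x
    rw [hgapp, abs_mul, abs_of_pos (inv_pos.2 hM0), inv_mul_le_iff₀ hM0]
    exact hM _ (e t).2 x
  have hgc : ∀ x, Continuous fun t => g t x := fun x =>
    continuous_const.mul ((WeakDual.eval_continuous x).comp
      (continuous_subtype_val.comp e.continuous))
  let i : K → {x : X // ‖x‖ ≤ 1} → unitInterval := fun t x =>
    ⟨(g t x.1 + 1) / 2, by
      have := abs_le.1 ((hg t x.1).trans x.2)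
      constructor <;> linarith⟩
  have hic : Continuous i := continuous_pi fun x =>
    Continuous.subtype_mk (((hgc x.1).add continuous_const).div_const 2) _
  have hinj : Injective i := by
    intro t t' htt
    have h1 : ∀ x : X, ‖x‖ ≤ 1 → (e t).1 x = (e t').1 x := by
      intro x hx
      have h2 : (g t x + 1) / 2 = (g t' x + 1) / 2 := congrArg Subtype.val (congrFun htt ⟨x, hx⟩)
      have h3 : M⁻¹ * (e t).1 x = M⁻¹ * (e t').1 x := by
        rw [← hgapp, ← hgapp]
        linarith
      exact mul_left_cancel₀ (inv_pos.2 hM0).ne' h3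
    apply e.injective
    apply Subtype.ext
    refine DFunLike.ext _ _ fun x => ?_
    have hx : 0 < ‖x‖ + 1 := by positivity
    have h2 := h1 ((‖x‖ + 1)⁻¹ • x) (by
      rw [norm_smul, norm_inv, Real.norm_of_nonneg hx.le, inv_mul_le_iff₀ hx]
      linarith)
    rw [map_smul, map_smul] at h2
    exact smul_right_injective ℝ (inv_pos.2 hx).ne' h2
  refine ⟨_, i, (hic.isClosedEmbedding hinj).isEmbedding, ?_⟩
  rintro p q hpq ⟨φ, hφ⟩
  refine hX (ContainsL1.of_isIndependentSeq g hg (fun n => (φ n).1) (fun n => (φ n).2)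
    (p := 2 * p - 1) (q := 2 * q - 1) (by linarith) ?_)
  convert hφ using 2 with n n
  · ext t
    change g t (φ n).1 < 2 * p - 1 ↔ (g t (φ n).1 + 1) / 2 < p
    constructor <;> intro <;> linarith
  · ext t
    change g t (φ n).1 > 2 * q - 1 ↔ (g t (φ n).1 + 1) / 2 > q
    constructor <;> intro <;> linarith

/-- A compact space separated by continuous functions that factor through a Banach space not
containing `ℓ¹` is weakly Radon–Nikodým. -/
lemma IsWRN.of_factorization {K : Type*} [TopologicalSpace K] [CompactSpace K] {X : Type}
    [NormedAddCommGroup X] [NormedSpace ℝ X] [CompleteSpace X] (hX : ¬ ContainsL1 X)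
    (T : X →L[ℝ] C(K, ℝ)) (hT : ∀ t t', (∀ x, T x t = T x t') → t = t') : IsWRN K := by
  let ev : K → WeakDual ℝ X := fun t =>
    StrongDual.toWeakDual ((ContinuousMap.evalCLM ℝ t).comp T)
  have hevapp : ∀ t x, ev t x = T x t := fun _ _ => rfl
  have hc : Continuous ev := WeakDual.continuous_of_continuous_eval fun x => (T x).continuous
  have hinj : Injective ev := fun t t' htt => hT t t' fun x => by
    rw [← hevapp, ← hevapp, htt]
  exact ⟨X, _, _, inferInstance, range ev, hX, isCompact_range hc,
    ⟨(hc.isClosedEmbedding hinj).isEmbedding.toHomeomorph⟩⟩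

lemma IsWRN.of_embedding {K : Type*} [TopologicalSpace K] [CompactSpace K] [T2Space K] {Γ : Type}
    {i : K → Γ → unitInterval} (hi : Topology.IsEmbedding i)
    (hind : ∀ p q : ℝ, p < q →
        ¬ ∃ φ : ℕ → Γ, IsIndependentSeq
            (fun n => {x : K | (i x (φ n) : ℝ) < p})
            (fun n => {x : K | (i x (φ n) : ℝ) > q})) : IsWRN K := by
  let f : Γ → C(K, ℝ) := fun γ =>
    ⟨fun t => (i t γ : ℝ), continuous_subtype_val.comp ((continuous_apply γ).comp hi.continuous)⟩
  have hf : ∀ γ t, f γ t ∈ Icc (0 : ℝ) 1 := fun γ t => (i t γ).2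
  let J : (Γ →₀ ℝ) →ₗ[ℝ] C(K, ℝ) := Finsupp.linearCombination ℝ f
  let q : Seminorm ℝ (Γ →₀ ℝ) := (normSeminorm ℝ C(K, ℝ)).comp J
  have hq : ∀ x, q x = ‖J x‖ := fun _ => rfl
  have hqp : q ≤ l1Seminorm Γ := by
    intro x
    have := (normSeminorm ℝ C(K, ℝ)).sum_smul_le x.support x f (C := 1) fun γ =>
      (ContinuousMap.norm_le _ zero_le_one).2 fun t => by
        rw [Real.norm_of_nonneg (hf γ t).1]
        exact (hf γ t).2
    rwa [mul_one] at this
  have H : ∀ (y : ℕ → Γ →₀ ℝ) (R δ : ℝ), (∀ n, l1Seminorm Γ (y n) ≤ R) → 0 < δ →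
      ∃ (L : ℕ) (a : ℕ → ℝ), q (∑ i ∈ Finset.range L, a i • y i) <
        δ * ∑ i ∈ Finset.range L, |a i| := by
    intro y R δ hR hδ
    by_contra! hy
    obtain ⟨p, q, hpq, hφ⟩ := exists_isIndependentSeq_of_linearCombination f hf y hR hδ
      fun L a => by simpa [hq, J] using hy L a
    exact hind p q hpq hφ
  obtain ⟨X, _, _, _, T, hX, hT⟩ := exists_factorization_not_containsL1
    (supInterpSeminorm (l1Seminorm Γ) q) J (fun x => le_supInterpSeminorm hqp x)
    (fun x C c hx hc => exists_supInterpSeminorm_sum_lt H x hx hc)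
  refine IsWRN.of_factorization hX T fun t t' htt => hi.injective (funext fun γ => ?_)
  obtain ⟨x, hx⟩ := hT (Finsupp.single γ 1)
  have h1 := htt x
  rw [hx] at h1
  simp only [J, Finsupp.linearCombination_single, one_smul] at h1
  exact Subtype.ext h1

end Main

/-- A compact Hausdorff space `K` is WRN iff there is a set `Γ` and a homeomorphic embedding
`i : K → [0,1]^Γ` such that for all reals `p < q`, the family of disjoint pairs
`({x | x_α < p}, {x | x_α > q})`, `α ∈ Γ`, contains no independent sequence. -/
theorem isWRN_iff_embedding_no_independent_sequence
    (K : Type*) [TopologicalSpace K] [CompactSpace K] [T2Space K] :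
    IsWRN K ↔ ∃ (Γ : Type) (i : K → Γ → unitInterval), Topology.IsEmbedding i ∧
      ∀ p q : ℝ, p < q →
        ¬ ∃ φ : ℕ → Γ, IsIndependentSeq
            (fun n => {x : K | (i x (φ n) : ℝ) < p})
            (fun n => {x : K | (i x (φ n) : ℝ) > q}) :=
  ⟨IsWRN.exists_embedding, fun ⟨_, _, hi, hind⟩ => IsWRN.of_embedding hi hind⟩
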